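/- Let m, s, k be positive integers with s = 4k and √m ≥ k. Let Γ_{2k} be the number of tuples S ∈ ([m] × [s] × [s])^{2k} such that every triple (i,j,h) ∈ S has j ≠ h, every column a ∈ [s] is touched an even number of times by S, and every diagonal a ∈ {−(m−1),…,s−1} is touched an even number of times by S. Then Γ_{2k} ≤ m^k · s^{2k} · k^{2k} · 2^{Ck} for some absolute constant C. -/

import Mathlib

open Finset

namespace GammaAux

/-- A multigraph with all degrees even has a balanced orientation. -/
lemma orient {ι V : Type*} [DecidableEq ι] [DecidableEq V] (E : Finset ι) :
    ∀ a b : ι → V,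
      (∀ v, Even (∑ e ∈ E, ((if a e = v then (1:ℤ) else 0) + (if b e = v then 1 else 0)))) →
      ∃ ε : ι → Bool, ∀ v, ∑ e ∈ E, (if ε e then (1:ℤ) else -1) *
        ((if a e = v then (1:ℤ) else 0) - (if b e = v then 1 else 0)) = 0 := by
  induction E using Finset.induction_on with
  | empty => intro a b _; exact ⟨fun _ => true, by simp⟩
  | insert e0 E he0 ih =>
    intro a b H
    by_cases hab : a e0 = b e0
    · obtain ⟨ε, hε⟩ := ih a b (by
        intro v
        have := H v
        rw [Finset.sum_insert he0, hab, Int.even_add] at this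
        exact this.1 (Even.add_self _))
      refine ⟨ε, fun v => ?_⟩
      rw [Finset.sum_insert he0, hε v, hab]; simp
    · have hex : ∃ e1 ∈ E, a e1 = b e0 ∨ b e1 = b e0 := by
        by_contra! hcon
        have := H (b e0)
        rw [Finset.sum_insert he0, Finset.sum_eq_zero (s := E)] at this
        · simp [hab] at this
        · intro e he
          simp [(hcon e he).1, (hcon e he).2]
      obtain ⟨e1, he1, h1⟩ := hex
      have hne : e1 ≠ e0 := fun h => he0 (h ▸ he1)
      by_cases h2 : a e1 = b e0
      · obtain ⟨ε, hε⟩ := ih (Function.update a e1 (a e0)) b (by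
          intro v
          have := H v
          rw [Finset.sum_insert he0, ← Finset.add_sum_erase _ _ he1] at this
          rw [← Finset.add_sum_erase _ _ he1]
          have hc : ∑ x ∈ E.erase e1, ((if Function.update a e1 (a e0) x = v then (1:ℤ) else 0) +
              (if b x = v then 1 else 0)) =
              ∑ x ∈ E.erase e1, ((if a x = v then (1:ℤ) else 0) + (if b x = v then 1 else 0)) := by
            apply Finset.sum_congr rfl
            intro x hx
            rw [Function.update_of_ne (Finset.ne_of_mem_erase hx)]
          rw [hc, Function.update_self]
          rw [h2] at this
          obtain ⟨r, hr⟩ := this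
          refine ⟨r - (if b e0 = v then 1 else 0), ?_⟩
          linarith)
        refine ⟨Function.update ε e0 (ε e1), fun v => ?_⟩
        have h3 := hε v
        rw [← Finset.add_sum_erase _ _ he1, Function.update_self] at h3
        rw [Finset.sum_insert he0, ← Finset.add_sum_erase _ _ he1, Function.update_self,
          Function.update_of_ne hne, h2]
        have hc : ∑ e ∈ E.erase e1, (if Function.update ε e0 (ε e1) e then (1:ℤ) else -1) *
            ((if a e = v then (1:ℤ) else 0) - (if b e = v then 1 else 0)) =
            ∑ e ∈ E.erase e1, (if ε e then (1:ℤ) else -1) *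
            ((if Function.update a e1 (a e0) e = v then (1:ℤ) else 0)
              - (if b e = v then 1 else 0)) := by
          apply Finset.sum_congr rfl
          intro x hx
          rw [Function.update_of_ne (Finset.ne_of_mem_erase hx), Function.update_of_ne]
          exact fun h => he0 (h ▸ Finset.mem_of_mem_erase hx)
        rw [hc]
        linarith
      · have h2' : b e1 = b e0 := h1.resolve_left h2
        obtain ⟨ε, hε⟩ := ih a (Function.update b e1 (a e0)) (by
          intro v
          have := H v
          rw [Finset.sum_insert he0, ← Finset.add_sum_erase _ _ he1] at this
          rw [← Finset.add_sum_erase _ _ he1]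
          have hc : ∑ x ∈ E.erase e1, ((if a x = v then (1:ℤ) else 0) +
              (if Function.update b e1 (a e0) x = v then 1 else 0)) =
              ∑ x ∈ E.erase e1, ((if a x = v then (1:ℤ) else 0) + (if b x = v then 1 else 0)) := by
            apply Finset.sum_congr rfl
            intro x hx
            rw [Function.update_of_ne (Finset.ne_of_mem_erase hx)]
          rw [hc, Function.update_self]
          rw [h2'] at this
          obtain ⟨r, hr⟩ := this
          refine ⟨r - (if b e0 = v then 1 else 0), ?_⟩
          linarith)
        refine ⟨Function.update ε e0 (!ε e1), fun v => ?_⟩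
        have h3 := hε v
        rw [← Finset.add_sum_erase _ _ he1, Function.update_self] at h3
        rw [Finset.sum_insert he0, ← Finset.add_sum_erase _ _ he1, Function.update_self,
          Function.update_of_ne hne, h2']
        have hc : ∑ e ∈ E.erase e1, (if Function.update ε e0 (!ε e1) e then (1:ℤ) else -1) *
            ((if a e = v then (1:ℤ) else 0) - (if b e = v then 1 else 0)) =
            ∑ e ∈ E.erase e1, (if ε e then (1:ℤ) else -1) *
            ((if a e = v then (1:ℤ) else 0)
              - (if Function.update b e1 (a e0) e = v then 1 else 0)) := by
          apply Finset.sum_congr rfl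
          intro x hx
          rw [Function.update_of_ne (Finset.ne_of_mem_erase hx), Function.update_of_ne]
          exact fun h => he0 (h ▸ Finset.mem_of_mem_erase hx)
        rw [hc]
        have hsg : (if (!ε e1) = true then (1:ℤ) else -1) = -(if ε e1 = true then (1:ℤ) else -1) := by
          cases ε e1 <;> simp
        rw [hsg]
        linarith

/-- Functions with equal fibre sizes differ by a permutation. -/
lemma exists_perm {α V : Type*} [Fintype α] [DecidableEq V] (f g : α → V)
    (h : ∀ v, (univ.filter fun l => f l = v).card = (univ.filter fun l => g l = v).card) :
    ∃ σ : Equiv.Perm α, ∀ l, g (σ l) = f l := by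
  have e : ∀ v, Nonempty ({a // f a = v} ≃ {b // g b = v}) := by
    intro v
    rw [← Fintype.card_eq, Fintype.card_subtype, Fintype.card_subtype, h v]
  exact ⟨Equiv.ofFiberEquiv fun v => (e v).some, fun l => Equiv.ofFiberEquiv_map _ l⟩

/-- `R` meets every cycle of `σ` exactly once. -/
def Transv {α : Type*} (σ : Equiv.Perm α) (R : Finset α) : Prop :=
  (∀ l, ∃ r ∈ R, ∃ n : ℕ, l = (σ ^ n) r) ∧ ∀ r ∈ R, ∀ r' ∈ R, σ.SameCycle r r' → r = r'

lemma exists_transv {α : Type*} [Fintype α] [DecidableEq α] (σ : Equiv.Perm α)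
    (hσ : ∀ l, σ l ≠ l) : ∃ R : Finset α, Transv σ R ∧ 2 * R.card ≤ Fintype.card α := by
  classical
  let q : α → Quotient (Equiv.Perm.SameCycle.setoid σ) := fun x => Quotient.mk _ x
  let ρ : α → α := fun x => (q x).out
  have hρ : ∀ x, σ.SameCycle (ρ x) x := fun x => Quotient.mk_out (s := Equiv.Perm.SameCycle.setoid σ) x
  have hρ2 : ∀ x y, σ.SameCycle x y → ρ x = ρ y := fun x y h => by
    have : q x = q y := Quotient.sound h
    simp only [ρ, this]
  have hT : Transv σ (univ.image ρ) := by
    constructor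
    · intro l
      refine ⟨ρ l, by simp, ?_⟩
      obtain ⟨n, hn⟩ := (hρ l).exists_nat_pow_eq
      exact ⟨n, hn.symm⟩
    · intro r hr r' hr' h
      obtain ⟨x, -, rfl⟩ := Finset.mem_image.1 hr
      obtain ⟨y, -, rfl⟩ := Finset.mem_image.1 hr'
      exact hρ2 _ _ (((hρ x).symm.trans h).trans (hρ y))
  refine ⟨univ.image ρ, hT, ?_⟩
  set R := univ.image ρ
  have h1 : (R.map σ.toEmbedding) ⊆ Rᶜ := by
    intro x hx
    obtain ⟨r, hr, rfl⟩ := Finset.mem_map.1 hx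
    rw [Finset.mem_compl]
    intro h
    exact hσ r (hT.2 r hr _ h (Equiv.Perm.sameCycle_apply_right.2 (Equiv.Perm.SameCycle.refl _ _))).symm
  have h2 := Finset.card_le_card h1
  rw [Finset.card_map, Finset.card_compl] at h2
  have := Finset.card_le_univ R
  omega

lemma perm_unique {α : Type*} (σ σ' : Equiv.Perm α) (R : Finset α)
    (h : Transv σ R) (h' : Transv σ' R) (hp : ∀ l, l ∉ R → σ.symm l = σ'.symm l) : σ = σ' := by
  have key : ∀ r ∈ R, ∀ n : ℕ, σ'.SameCycle r ((σ ^ n) r) := by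
    intro r hr n
    induction n with
    | zero => exact Equiv.Perm.SameCycle.refl _ _
    | succ n ih =>
      by_cases hx : (σ ^ (n+1)) r ∈ R
      · have : r = (σ ^ (n+1)) r := h.2 r hr _ hx ⟨(n+1 : ℕ), by rw [zpow_natCast]⟩
        rw [← this]
      · have h1 := hp _ hx
        have h2 : σ.symm ((σ ^ (n+1)) r) = (σ ^ n) r := by
          rw [pow_succ', Equiv.Perm.mul_apply, Equiv.symm_apply_apply]
        rw [h2] at h1
        have h3 : (σ ^ (n+1)) r = σ' ((σ ^ n) r) := by rw [h1, Equiv.apply_symm_apply]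
        rw [h3]
        exact Equiv.Perm.sameCycle_apply_right.2 ih
  ext e
  by_cases hR : σ e ∈ R
  · have h1 : σ' e ∈ R := by
      by_contra hc
      have := hp _ hc
      rw [Equiv.symm_apply_apply, Equiv.symm_apply_eq] at this
      exact hc (this ▸ hR)
    obtain ⟨r, hr, n, hn⟩ := h.1 e
    have h2 : r = σ e := h.2 r hr _ hR ⟨(n+1 : ℕ), by
      rw [zpow_natCast, pow_succ', Equiv.Perm.mul_apply, ← hn]⟩
    have h3 : r = σ' e := h'.2 r hr _ h1 (Equiv.Perm.sameCycle_apply_right.2 (hn ▸ key r hr n))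
    rw [← h2, ← h3]
  · have := hp _ hR
    rw [Equiv.symm_apply_apply] at this
    rw [this, Equiv.apply_symm_apply, ← this]

/-- The oriented tuples whose matching permutation has transversal `R`. -/
def TR (n m s : ℕ) (R : Finset (Fin n)) : Set (Fin n → Fin m × Fin s × Fin s) :=
  {S | ∃ σ : Equiv.Perm (Fin n), Transv σ R ∧
    ∀ l, ((S l).2.2 : ℤ) - ((S l).1 : ℤ) = ((S (σ l)).2.1 : ℤ) - ((S (σ l)).1 : ℤ)}

lemma card_TR (n m s : ℕ) (R : Finset (Fin n)) :
    Nat.card (TR n m s R) ≤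
      n ^ (n - R.card) * s ^ (n - R.card) * m ^ R.card * s ^ n := by
  classical
  choose σ hσ hS using fun S : TR n m s R => S.2
  let Φ : TR n m s R → ({l // l ∉ R} → Fin n) × ({l // l ∉ R} → Fin s) ×
      ({l // l ∈ R} → Fin m) × (Fin n → Fin s) := fun S =>
    (fun l => (σ S).symm l, fun l => (S.1 ((σ S).symm l)).2.2, fun l => (S.1 l).1,
      fun l => (S.1 l).2.1)
  have hinj : Function.Injective Φ := by
    intro S S' h
    simp only [Φ, Prod.mk.injEq] at h
    obtain ⟨hp, hg, hi, hj⟩ := h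
    have hs : σ S = σ S' := perm_unique _ _ R (hσ S) (hσ S') fun l hl => congrFun hp ⟨l, hl⟩
    have e1 := hS S
    have e2 := hS S'
    have t := hσ S
    rw [← hs] at e2 hg
    generalize σ S = τ at *
    have hj' : ∀ l, (S.1 l).2.1 = (S'.1 l).2.1 := fun l => congrFun hj l
    have hi' : ∀ r ∈ R, (S.1 r).1 = (S'.1 r).1 := fun l hl => congrFun hi ⟨l, hl⟩
    have hg' : ∀ l, l ∉ R → (S.1 (τ.symm l)).2.2 = (S'.1 (τ.symm l)).2.2 :=
      fun l hl => congrFun hg ⟨l, hl⟩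
    have key : ∀ r ∈ R, ∀ n : ℕ, (S.1 ((τ ^ n) r)).1 = (S'.1 ((τ ^ n) r)).1 := by
      intro r hr n
      induction n with
      | zero => simpa using hi' r hr
      | succ n ih =>
        by_cases hx : (τ ^ (n+1)) r ∈ R
        · exact hi' _ hx
        · have a3 := hg' _ hx
          rw [pow_succ', Equiv.Perm.mul_apply] at a3 ⊢
          rw [Equiv.symm_apply_apply] at a3
          have a1 := e1 ((τ ^ n) r)
          have a2 := e2 ((τ ^ n) r)
          rw [hj', ih, a3] at a1
          apply Fin.ext
          omega
    have key' : ∀ l, (S.1 l).1 = (S'.1 l).1 := by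
      intro l
      obtain ⟨r, hr, n, rfl⟩ := t.1 l
      exact key r hr n
    apply Subtype.ext
    funext l
    refine Prod.ext (key' l) (Prod.ext (hj' l) ?_)
    have a1 := e1 l
    have a2 := e2 l
    rw [hj', key', key'] at a1
    apply Fin.ext
    omega
  have := Nat.card_le_card_of_injective Φ hinj
  refine this.trans (le_of_eq ?_)
  simp [Nat.card_eq_fintype_card, Fintype.card_subtype_compl, mul_assoc]

/-- Swap the two columns of the triples selected by `ε`. -/
def swp {n m s : ℕ} (ε : Fin n → Bool) (S : Fin n → Fin m × Fin s × Fin s) :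
    Fin n → Fin m × Fin s × Fin s :=
  fun l => if ε l then S l else ((S l).1, (S l).2.2, (S l).2.1)

lemma swp_swp {n m s : ℕ} (ε : Fin n → Bool) (S : Fin n → Fin m × Fin s × Fin s) :
    swp ε (swp ε S) = S := by
  funext l
  unfold swp
  split_ifs <;> rfl

lemma valid_mem {n m s : ℕ} (S : Fin n → Fin m × Fin s × Fin s)
    (h1 : ∀ l, (S l).2.1 ≠ (S l).2.2)
    (h3 : ∀ a : ℤ, Even (Finset.univ.filter fun l =>
              ((S l).2.1 : ℤ) - ((S l).1 : ℤ) = a ∨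
                ((S l).2.2 : ℤ) - ((S l).1 : ℤ) = a).card) :
    ∃ (ε : Fin n → Bool) (R : Finset (Fin n)), 2 * R.card ≤ n ∧ swp ε S ∈ TR n m s R := by
  classical
  have hne : ∀ l, ((S l).2.1 : ℤ) - ((S l).1 : ℤ) ≠ ((S l).2.2 : ℤ) - ((S l).1 : ℤ) := by
    intro l h
    apply h1 l
    apply Fin.ext
    omega
  obtain ⟨ε, hε⟩ := orient (univ : Finset (Fin n)) (fun l => ((S l).2.1 : ℤ) - ((S l).1 : ℤ))
    (fun l => ((S l).2.2 : ℤ) - ((S l).1 : ℤ)) (by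
      intro v
      have := h3 v
      rw [← Int.even_coe_nat, Finset.card_filter] at this
      push_cast at this
      convert this using 1
      apply Finset.sum_congr rfl
      intro l _
      have := hne l
      split_ifs <;> simp_all)
  let T := swp ε S
  have hT : ∀ l, ((T l).2.1 : ℤ) - ((T l).1 : ℤ) ≠ ((T l).2.2 : ℤ) - ((T l).1 : ℤ) := by
    intro l
    have := hne l
    simp only [T, swp]
    split_ifs
    · exact this
    · exact this.symm
  obtain ⟨σ, hσ⟩ := exists_perm (fun l => ((T l).2.2 : ℤ) - ((T l).1 : ℤ))
    (fun l => ((T l).2.1 : ℤ) - ((T l).1 : ℤ)) (by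
      intro v
      have h := hε v
      zify
      rw [Finset.card_filter, Finset.card_filter]
      push_cast
      rw [eq_comm, ← sub_eq_zero, ← Finset.sum_sub_distrib]
      refine Eq.trans ?_ h
      apply Finset.sum_congr rfl
      intro l _
      simp only [T, swp]
      by_cases hl : ε l <;> simp [hl])
  obtain ⟨R, hR, hc⟩ := exists_transv σ (by
    intro l h
    have := hσ l
    rw [h] at this
    exact hT l this)
  rw [Fintype.card_fin] at hc
  exact ⟨ε, R, hc, σ, hR, fun l => (hσ l).symm⟩

lemma arith (m k c : ℕ) (hc : c ≤ k) (hm : k ^ 2 ≤ m) :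
    (2*k) ^ (2*k - c) * (4*k) ^ (2*k - c) * m ^ c ≤ 64 ^ k * m ^ k * k ^ (2*k) := by
  obtain ⟨d, rfl⟩ := Nat.exists_eq_add_of_le hc
  have h1 : 2 * (c + d) - c = (c + d) + d := by omega
  rw [h1, ← mul_pow]
  set K := c + d with hK
  calc (2 * K * (4 * K)) ^ (K + d) * m ^ c = (8:ℕ) ^ (K + d) * K ^ (2*K) * ((K^2) ^ d * m ^ c) := by
        rw [show 2 * K * (4 * K) = 8 * K^2 by ring, mul_pow, pow_add (K^2), ← pow_mul K 2 K]; ring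
    _ ≤ 8 ^ (K + K) * K ^ (2*K) * (m ^ d * m ^ c) := by
        gcongr
        · norm_num
        · omega
    _ = 64 ^ K * m ^ K * K ^ (2*K) := by
        rw [← pow_add, ← two_mul, pow_mul, add_comm d c, ← hK]; ring

lemma main_nat (m s k : ℕ) (hs : s = 4 * k) (hm : k ^ 2 ≤ m)
    (P : (Fin (2 * k) → Fin m × Fin s × Fin s) → Prop)
    (hP : ∀ S, P S → ∃ (ε : Fin (2*k) → Bool) (R : Finset (Fin (2*k))),
      2 * R.card ≤ 2 * k ∧ swp ε S ∈ TR (2*k) m s R) :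
    Nat.card {S // P S} ≤ m ^ k * s ^ (2*k) * k ^ (2*k) * 2 ^ (10 * k) := by
  classical
  choose! ε R hR hT using hP
  let Ψ : {S // P S} → (Fin (2*k) → Bool) ×
      (Σ R : {R : Finset (Fin (2*k)) // 2 * R.card ≤ 2 * k}, TR (2*k) m s R.1) :=
    fun S => (ε S.1, ⟨⟨R S.1, hR _ S.2⟩, ⟨swp (ε S.1) S.1, hT _ S.2⟩⟩)
  have hinj : Function.Injective Ψ := by
    intro S S' h
    have h1 : ε S.1 = ε S'.1 := congrArg Prod.fst h
    have h2 : swp (ε S.1) S.1 = swp (ε S'.1) S'.1 := congrArg (fun x => (x.2.2.1)) h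
    apply Subtype.ext
    rw [← swp_swp (ε S.1) S.1, h2, h1, swp_swp]
  refine (Nat.card_le_card_of_injective Ψ hinj).trans ?_
  rw [Nat.card_prod, Nat.card_sigma]
  have hb : ∀ R : {R : Finset (Fin (2*k)) // 2 * R.card ≤ 2 * k},
      Nat.card (TR (2*k) m s R.1) ≤ 64 ^ k * m ^ k * k ^ (2*k) * s ^ (2*k) := by
    intro R
    refine (card_TR _ _ _ _).trans ?_
    have := arith m k R.1.card (by have := R.2; omega) hm
    rw [← hs] at this
    exact Nat.mul_le_mul_right _ this
  have h1 : Nat.card (Fin (2*k) → Bool) = 2 ^ (2*k) := by simp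
  have h2 : Fintype.card {R : Finset (Fin (2*k)) // 2 * R.card ≤ 2 * k} ≤ 2 ^ (2*k) := by
    refine (Fintype.card_subtype_le _).trans (by simp)
  calc _ ≤ 2 ^ (2*k) * (∑ R : {R : Finset (Fin (2*k)) // 2 * R.card ≤ 2 * k},
          64 ^ k * m ^ k * k ^ (2*k) * s ^ (2*k)) := by
        rw [h1]
        exact Nat.mul_le_mul_left _ (Finset.sum_le_sum fun R _ => hb R)
    _ ≤ 2 ^ (2*k) * (2 ^ (2*k) * (64 ^ k * m ^ k * k ^ (2*k) * s ^ (2*k))) := by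
        rw [Finset.sum_const, smul_eq_mul, Finset.card_univ]
        gcongr
    _ = _ := by
        rw [show (64:ℕ) = 2 ^ 6 by norm_num, ← pow_mul, show 10 * k = 2*k + 2*k + 6*k by ring,
          pow_add, pow_add]
        ring

end GammaAux

/-- Upper bound on `Γ_{2k}`: with `s = 4k` and `√m ≥ k`, the number of tuples of `2k` triples
in `[m] × [s] × [s]` with distinct entries in each triple, touching every column and every
diagonal an even number of times, is at most `m^k s^{2k} k^{2k} 2^{Ck}` for an absolute
constant `C`. -/
theorem gamma_two_k_upper :
    ∃ C : ℝ, 0 < C ∧ ∀ m s k : ℕ, 0 < m → 0 < k → s = 4 * k → (k : ℝ) ≤ Real.sqrt m →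
      (Nat.card {S : Fin (2 * k) → Fin m × Fin s × Fin s //
          (∀ l, (S l).2.1 ≠ (S l).2.2) ∧
          (∀ a : Fin s,
            Even (Finset.univ.filter fun l => (S l).2.1 = a ∨ (S l).2.2 = a).card) ∧
          (∀ a : ℤ,
            Even (Finset.univ.filter fun l =>
              ((S l).2.1 : ℤ) - ((S l).1 : ℤ) = a ∨
                ((S l).2.2 : ℤ) - ((S l).1 : ℤ) = a).card)} : ℝ) ≤
        (m : ℝ) ^ k * (s : ℝ) ^ (2 * k) * (k : ℝ) ^ (2 * k) * 2 ^ (C * k) := by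
  refine ⟨10, by norm_num, ?_⟩
  intro m s k _ _ hs hkm
  have hm : k ^ 2 ≤ m := by
    have := (Real.le_sqrt (by positivity) (by positivity)).1 hkm
    exact_mod_cast this
  have e : (2:ℝ) ^ ((10:ℝ) * k) = 2 ^ (10 * k) := by
    rw [← Real.rpow_natCast]; push_cast; rfl
  rw [e]
  have h := GammaAux.main_nat m s k hs hm (fun S =>
          (∀ l, (S l).2.1 ≠ (S l).2.2) ∧
          (∀ a : Fin s,
            Even (Finset.univ.filter fun l => (S l).2.1 = a ∨ (S l).2.2 = a).card) ∧
          (∀ a : ℤ,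
            Even (Finset.univ.filter fun l =>
              ((S l).2.1 : ℤ) - ((S l).1 : ℤ) = a ∨
                ((S l).2.2 : ℤ) - ((S l).1 : ℤ) = a).card))
    (fun S hS => GammaAux.valid_mem S hS.1 hS.2.2)
  exact_mod_cast h
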